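/- The quotient of the direct sum of two affine monoids Λ₁ ⊕ Λ₂ by the smallest monoid congruence identifying a reducible element ρ₁ of Λ₁ with a reducible element ρ₂ of Λ₂ is again an affine monoid: it is cancellative, pointed, and finitely generated. -/

import Mathlib

/-- The smallest additive congruence on `Λ₁ ⊕ Λ₂` identifying `ρ₁ ∈ Λ₁` with
`ρ₂ ∈ Λ₂`. -/
def glueCon {Λ₁ Λ₂ : Type*} [AddCommMonoid Λ₁] [AddCommMonoid Λ₂]
    (ρ₁ : Λ₁) (ρ₂ : Λ₂) : AddCon (Λ₁ × Λ₂) :=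
  addConGen (fun x y : Λ₁ × Λ₂ => x = (ρ₁, 0) ∧ y = ((0 : Λ₁), ρ₂))

/-- An explicit description of the gluing congruence. -/
def glueExplicit {A B : Type*} [AddCancelCommMonoid A] [AddCancelCommMonoid B]
    (r : A) (s : B) : AddCon (A × B) where
  r x y := ∃ n m : ℕ, x.1 + m • r = y.1 + n • r ∧ x.2 + n • s = y.2 + m • s
  iseqv := by
    refine ⟨fun x => ⟨0, 0, rfl, rfl⟩, ?_, ?_⟩
    · rintro x y ⟨n, m, h1, h2⟩
      exact ⟨m, n, h1.symm, h2.symm⟩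
    · rintro x y z ⟨n, m, h1, h2⟩ ⟨p, q, h3, h4⟩
      refine ⟨n + p, m + q, ?_, ?_⟩
      · calc x.1 + (m + q) • r = (x.1 + m • r) + q • r := by rw [add_nsmul]; abel
          _ = (y.1 + q • r) + n • r := by rw [h1]; abel
          _ = z.1 + (n + p) • r := by rw [h3, add_nsmul]; abel
      · calc x.2 + (n + p) • s = (x.2 + n • s) + p • s := by rw [add_nsmul]; abel
          _ = (y.2 + p • s) + m • s := by rw [h2]; abel
          _ = z.2 + (m + q) • s := by rw [h4, add_nsmul]; abel
  add' := by
    rintro w x y z ⟨n, m, h1, h2⟩ ⟨p, q, h3, h4⟩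
    refine ⟨n + p, m + q, ?_, ?_⟩
    · calc w.1 + y.1 + (m + q) • r = (w.1 + m • r) + (y.1 + q • r) := by rw [add_nsmul]; abel
        _ = x.1 + z.1 + (n + p) • r := by rw [h1, h3, add_nsmul]; abel
    · calc w.2 + y.2 + (n + p) • s = (w.2 + n • s) + (y.2 + p • s) := by rw [add_nsmul]; abel
        _ = x.2 + z.2 + (m + q) • s := by rw [h2, h4, add_nsmul]; abel

theorem glueCon_step {A B : Type*} [AddCancelCommMonoid A] [AddCancelCommMonoid B]
    (r : A) (s : B) (k : ℕ) (a : A) (b : B) :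
    glueCon r s (a + k • r, b) (a, b + k • s) := by
  have h : glueCon r s (r, 0) (0, s) := AddConGen.Rel.of _ _ ⟨rfl, rfl⟩
  have h2 := (glueCon r s).add ((glueCon r s).refl (a, b)) ((glueCon r s).nsmul k h)
  simpa using h2

theorem glueCon_iff {A B : Type*} [AddCancelCommMonoid A] [AddCancelCommMonoid B]
    (r : A) (s : B) (x y : A × B) :
    glueCon r s x y ↔
      ∃ n m : ℕ, x.1 + m • r = y.1 + n • r ∧ x.2 + n • s = y.2 + m • s := by
  constructor
  · intro h
    have hle : glueCon r s ≤ glueExplicit r s := by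
      refine AddCon.addConGen_le.2 ?_
      rintro x y ⟨rfl, rfl⟩
      exact ⟨1, 0, by simp, by simp⟩
    exact hle h
  · obtain ⟨a, b⟩ := x
    obtain ⟨c, d⟩ := y
    rintro ⟨n, m, h1, h2⟩
    dsimp only at h1 h2
    rcases le_total m n with h | h
    · obtain ⟨k, rfl⟩ := Nat.exists_eq_add_of_le h
      have e1 : a = c + k • r := by
        apply add_right_cancel (b := m • r)
        rw [h1, add_nsmul]; abel
      have e2 : d = b + k • s := by
        apply add_right_cancel (b := m • s)
        rw [← h2, add_nsmul]; abel
      rw [e1, e2]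
      exact glueCon_step r s k c b
    · obtain ⟨k, rfl⟩ := Nat.exists_eq_add_of_le h
      have e1 : c = a + k • r := by
        apply add_right_cancel (b := n • r)
        rw [← h1, add_nsmul]; abel
      have e2 : b = d + k • s := by
        apply add_right_cancel (b := n • s)
        rw [h2, add_nsmul]; abel
      rw [e1, e2]
      exact (glueCon r s).symm (glueCon_step r s k a d)

theorem pointed_aux {A : Type*} [AddCancelCommMonoid A]
    (hp : ∀ a b : A, a + b = 0 → a = 0 ∧ b = 0) {r : A}
    (hr : ∃ σ τ : A, σ ≠ 0 ∧ τ ≠ 0 ∧ σ + τ = r) {a : A} {k : ℕ}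
    (h : a + k • r = 0) : a = 0 ∧ k = 0 := by
  obtain ⟨h1, h2⟩ := hp _ _ h
  refine ⟨h1, ?_⟩
  rcases k with _ | k
  · rfl
  · rw [succ_nsmul] at h2
    obtain ⟨σ, τ, hσ, -, rfl⟩ := hr
    exact absurd (hp _ _ (hp _ _ h2).2).1 hσ

theorem glueCon_zero {A B : Type*} [AddCancelCommMonoid A] [AddCancelCommMonoid B]
    (hA : ∀ a b : A, a + b = 0 → a = 0 ∧ b = 0)
    (hB : ∀ a b : B, a + b = 0 → a = 0 ∧ b = 0) {r : A} {s : B}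
    (hr : ∃ σ τ : A, σ ≠ 0 ∧ τ ≠ 0 ∧ σ + τ = r)
    (hs : ∃ σ τ : B, σ ≠ 0 ∧ τ ≠ 0 ∧ σ + τ = s) {x : A × B}
    (h : glueCon r s x 0) : x = 0 := by
  obtain ⟨a, b⟩ := x
  obtain ⟨n, m, h1, h2⟩ := (glueCon_iff r s _ _).1 h
  simp only [Prod.fst_zero, Prod.snd_zero, zero_add] at h1 h2
  rcases le_total m n with h | h
  · obtain ⟨k, rfl⟩ := Nat.exists_eq_add_of_le h
    have e : b + k • s = 0 := by
      apply add_right_cancel (b := m • s)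
      rw [zero_add, add_assoc, ← add_nsmul, add_comm k m, h2]
    obtain ⟨rfl, rfl⟩ := pointed_aux hB hs e
    have : a = 0 := by simpa using h1
    rw [this]; rfl
  · obtain ⟨k, rfl⟩ := Nat.exists_eq_add_of_le h
    have e : a + k • r = 0 := by
      apply add_right_cancel (b := n • r)
      rw [zero_add, add_assoc, ← add_nsmul, add_comm k n, h1]
    obtain ⟨rfl, rfl⟩ := pointed_aux hA hr e
    have : b = 0 := by simpa using h2
    rw [this]; rfl

/-- the glued monoid `Λ = (Λ₁ ⊕ Λ₂)/(ρ₁ ∼ ρ₂)` of two affine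
monoids along reducible elements is again an affine monoid: cancellative,
pointed and finitely generated. -/
theorem stmt15 {Λ₁ Λ₂ : Type*} [AddCancelCommMonoid Λ₁] [AddCancelCommMonoid Λ₂]
    [AddMonoid.FG Λ₁] [AddMonoid.FG Λ₂]
    (hpointed₁ : ∀ a b : Λ₁, a + b = 0 → a = 0 ∧ b = 0)
    (hpointed₂ : ∀ a b : Λ₂, a + b = 0 → a = 0 ∧ b = 0)
    (ρ₁ : Λ₁) (ρ₂ : Λ₂)
    (hρ₁ : ∃ σ τ : Λ₁, σ ≠ 0 ∧ τ ≠ 0 ∧ σ + τ = ρ₁)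
    (hρ₂ : ∃ σ τ : Λ₂, σ ≠ 0 ∧ τ ≠ 0 ∧ σ + τ = ρ₂) :
    (∀ a b c : (glueCon ρ₁ ρ₂).Quotient, a + c = b + c → a = b) ∧
    (∀ a b : (glueCon ρ₁ ρ₂).Quotient, a + b = 0 → a = 0 ∧ b = 0) ∧
    AddMonoid.FG (glueCon ρ₁ ρ₂).Quotient := by
  refine ⟨?_, ?_, ?_⟩
  · intro a b c
    induction a using AddCon.induction_on with | _ a
    induction b using AddCon.induction_on with | _ b
    induction c using AddCon.induction_on with | _ c
    intro h
    rw [← AddCon.coe_add, ← AddCon.coe_add, AddCon.eq, glueCon_iff] at h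
    rw [AddCon.eq, glueCon_iff]
    obtain ⟨n, m, h1, h2⟩ := h
    refine ⟨n, m, ?_, ?_⟩
    · apply add_right_cancel (b := c.1)
      rw [add_right_comm, add_right_comm b.1]
      exact h1
    · apply add_right_cancel (b := c.2)
      rw [add_right_comm, add_right_comm b.2]
      exact h2
  · intro a b
    induction a using AddCon.induction_on with | _ a
    induction b using AddCon.induction_on with | _ b
    intro h
    rw [← AddCon.coe_add, ← AddCon.coe_zero, AddCon.eq] at h
    have h0 := glueCon_zero hpointed₁ hpointed₂ hρ₁ hρ₂ h
    have e1 := hpointed₁ a.1 b.1 (congrArg Prod.fst h0)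
    have e2 := hpointed₂ a.2 b.2 (congrArg Prod.snd h0)
    have ea : a = 0 := Prod.ext e1.1 e2.1
    have eb : b = 0 := Prod.ext e1.2 e2.2
    rw [ea, eb]
    exact ⟨rfl, rfl⟩
  · exact AddMonoid.fg_of_surjective (glueCon ρ₁ ρ₂).mk' AddCon.mk'_surjective
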